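/- Let K be a commutative unital ring, k ≥ 1, n > k, and ā, b̄, c̄ ∈ K^k. Set d_i := b_i·c_i for 1 ≤ i ≤ k, d̄ := (d_1,…,d_k), d := d_1⋯d_k, write n = m·k + r by Euclidean division (0 ≤ r < k), and let U(i) := U_i(π^{ā,−d̄}(k,k), d). Then det(T^k_n(ā,b̄,c̄)) = U(m+1)·α^{ā,−d̄}(r,k) + d_k·d_1⋯d_r·U(m)·α_{r+1}^{ā,−d̄}(k−r−2,k), where α_{r+1} denotes the shift of α by r+1 and α(−1,k) := 0. -/

import Mathlib

noncomputable section

/-- The polynomial ring `ℤ[x_1,…,x_k,y_1,…,y_k]` with indices extended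
periodically (`x_{i+k} = x_i`, `y_{i+k} = y_i`), realized by indexing the
two families of variables by `ZMod k`. -/
abbrev ContRing (k : ℕ) := MvPolynomial (ZMod k ⊕ ZMod k) ℤ

/-- The variable `x_i` (indices taken modulo `k`). -/
def Xv (k : ℕ) (i : ℕ) : ContRing k := MvPolynomial.X (Sum.inl (i : ZMod k))

/-- The variable `y_i` (indices taken modulo `k`). -/
def Yv (k : ℕ) (i : ℕ) : ContRing k := MvPolynomial.X (Sum.inr (i : ZMod k))

/-- `C2 S m` is the collection of `m`-element subsets `{i_1<⋯<i_m}` of `S`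
satisfying `i_{j+1} − i_j ≥ 2` for all `j`. -/
def C2 (S : Finset ℕ) (m : ℕ) : Finset (Finset ℕ) :=
  (Finset.powersetCard m S).filter fun I => ∀ i ∈ I, ∀ j ∈ I, i < j → i + 2 ≤ j

/-- The monomial `p(I)`: obtained from `x_1 x_2 ⋯ x_r` by replacing, for each
`i ∈ I`, the adjacent pair `x_i x_{i+1}` by `y_i`. -/
def pMono (k r : ℕ) (I : Finset ℕ) : ContRing k :=
  (∏ i ∈ I, Yv k i) *
    ∏ j ∈ (Finset.Icc 1 r).filter (fun j => j ∉ I ∧ j - 1 ∉ I), Xv k j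

/-- The monomial `q(I)`: obtained from `y_k · x_2 x_3 ⋯ x_{r−1}` by replacing,
for each `i ∈ I`, the adjacent pair `x_i x_{i+1}` by `y_i`. -/
def qMono (k r : ℕ) (I : Finset ℕ) : ContRing k :=
  Yv k k * (∏ i ∈ I, Yv k i) *
    ∏ j ∈ (Finset.Icc 2 (r - 1)).filter (fun j => j ∉ I ∧ j - 1 ∉ I), Xv k j

/-- The continuant polynomial of type `α` (combinatorial definition):
`α(r,k) = Σ_{m=0}^{⌊r/2⌋} Σ_{I ∈ C₂({1,…,r−1},m)} p(I)`. -/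
def alphaComb (k r : ℕ) : ContRing k :=
  ∑ m ∈ Finset.range (r / 2 + 1), ∑ I ∈ C2 (Finset.Icc 1 (r - 1)) m, pMono k r I

/-- The continuant polynomial of type `α`, extended to all `n` by the
recurrence `α(n,k) = x_n·α(n−1,k) + y_{n−1}·α(n−2,k)` for `n > k`. -/
def alphaN (k : ℕ) (n : ℕ) : ContRing k :=
  if h : n ≤ k then alphaComb k n
  else Xv k n * alphaN k (n - 1) + Yv k (n - 1) * alphaN k (n - 2)
termination_by n
decreasing_by all_goals omega

/-- The continuant polynomial of type `α` with an integer argument,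
so that `α(−1,k) = 0`. -/
def alphaZ (k : ℕ) (r : ℤ) : ContRing k :=
  if r < 0 then 0 else alphaN k r.toNat

/-- The continuant polynomial of type `β`:
`β(r,k) = Σ_{m=0}^{⌊(r−2)/2⌋} Σ_{I ∈ C₂({2,…,r−2},m)} q(I)`, with
`β(0,k) = β(1,k) = 0`. -/
def betaP (k : ℕ) : ℕ → ContRing k
  | 0 => 0
  | 1 => 0
  | r + 2 => ∑ m ∈ Finset.range (r / 2 + 1), ∑ I ∈ C2 (Finset.Icc 2 r) m, qMono k (r + 2) I

/-- The continuant polynomial of type `π`: `π(r,k) = α(r,k) + β(r,k)`. -/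
def piP (k r : ℕ) : ContRing k := alphaN k r + betaP k r

/-- The shift by `s`: the ring automorphism of `ℤ[x_1,…,x_k,y_1,…,y_k]`
sending `x_i ↦ x_{i+s}` and `y_i ↦ y_{i+s}` (indices modulo `k`). -/
def shiftP (k s : ℕ) : ContRing k →ₐ[ℤ] ContRing k :=
  MvPolynomial.rename (Sum.map (· + (s : ZMod k)) (· + (s : ZMod k)))

/-- The generalized Fibonacci polynomial of order `m`, evaluated at `x, y`:
`U_m(x,y) = Σ_{i=0}^{⌊(m−1)/2⌋} (−1)^i · C(m−1−i, i) · x^{m−1−2i} · y^i`,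
with `U_0 = 0`. -/
def genFib {K : Type*} [CommRing K] (x y : K) : ℕ → K
  | 0 => 0
  | m + 1 => ∑ i ∈ Finset.range (m / 2 + 1),
      (-1 : K) ^ i * (Nat.choose (m - i) i : K) * x ^ (m - 2 * i) * y ^ i

/-- The tridiagonal `k`-Toeplitz matrix `T^k_n(ā,b̄,c̄)`: the `n×n` matrix whose
`(i,i)` entry is `a_i`, `(i,i+1)` entry is `b_i`, `(i+1,i)` entry is `c_i`
(1-based indices, extended periodically modulo `k`), and all other entries `0`. -/
def triToeplitz {K : Type*} [CommRing K] (k n : ℕ) (a b c : ZMod k → K) :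
    Matrix (Fin n) (Fin n) K :=
  Matrix.of fun i j =>
    if (i : ℕ) = (j : ℕ) then a (((i : ℕ) + 1 : ℕ) : ZMod k)
    else if (j : ℕ) = (i : ℕ) + 1 then b (((i : ℕ) + 1 : ℕ) : ZMod k)
    else if (i : ℕ) = (j : ℕ) + 1 then c (((j : ℕ) + 1 : ℕ) : ZMod k)
    else 0

/-- The universal determinant `D^{ā,d̄}(n,k)`: the determinant of the `n×n`
tridiagonal matrix with main diagonal generated periodically by `ā`, all
upper-diagonal entries `1`, and lower diagonal generated periodically by `d̄`. -/
def univDet {K : Type*} [CommRing K] (k : ℕ) (a d : ZMod k → K) (n : ℕ) : K :=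
  (triToeplitz k n a (fun _ => 1) d).det

/-- The universal determinant with an integer size argument, so that
`D^{ā,d̄}(−1,k) = 0` (and `D^{ā,d̄}(0,k) = 1`). -/
def univDetZ {K : Type*} [CommRing K] (k : ℕ) (a d : ZMod k → K) (n : ℤ) : K :=
  if n < 0 then 0 else univDet k a d n.toNat

/-- The cyclic shift `σ_s` of a periodic vector by `s` places to the left:
`(σ_s a)_i = a_{i+s}`. -/
def shiftVec {K : Type*} {k : ℕ} (s : ℕ) (a : ZMod k → K) : ZMod k → K :=
  fun i => a (i + (s : ZMod k))


/-- The continuant of the sequences `x, y` starting after position `s`, indexed so that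
`continuant x y s (n + 1)` has degree `n` and `continuant x y s 0 = 0`. -/
def continuant {R : Type*} [CommRing R] (x y : ℕ → R) (s : ℕ) : ℕ → R
  | 0 => 0
  | 1 => 1
  | n + 2 => x (s + n + 1) * continuant x y s (n + 1) + y (s + n) * continuant x y s n

section Continuant

variable {R : Type*} [CommRing R] (x y : ℕ → R)

theorem continuant_zero (s : ℕ) : continuant x y s 0 = 0 := by simp [continuant]

theorem continuant_one (s : ℕ) : continuant x y s 1 = 1 := by simp [continuant]

theorem continuant_add_two (s n : ℕ) : continuant x y s (n + 2) =
    x (s + n + 1) * continuant x y s (n + 1) + y (s + n) * continuant x y s n := by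
  rw [continuant]

/-- Expansion of the continuant at its first variable. -/
theorem continuant_add_two' (s n : ℕ) : continuant x y s (n + 2) =
    x (s + 1) * continuant x y (s + 1) (n + 1) + y (s + 1) * continuant x y (s + 2) n := by
  induction n using Nat.twoStepInduction with
  | zero => simp [continuant]
  | one => simp [continuant]; ring
  | more n ih₀ ih₁ =>
    rw [continuant_add_two x y s (n + 2), ih₀, ih₁, continuant_add_two x y (s + 1) (n + 1),
      continuant_add_two x y (s + 2) n, show s + 1 + (n + 1) = s + (n + 2) by ring,
      show s + 2 + n = s + (n + 2) by ring]
    ring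

theorem map_continuant {S : Type*} [CommRing S] (f : R →+* S) (s n : ℕ) :
    f (continuant x y s n) = continuant (fun i => f (x i)) (fun i => f (y i)) s n := by
  induction n using Nat.twoStepInduction with
  | zero => simp [continuant]
  | one => simp [continuant]
  | more n ih₀ ih₁ => simp [continuant_add_two, ih₀, ih₁]

theorem continuant_shift (t s n : ℕ) :
    continuant (fun i => x (i + t)) (fun i => y (i + t)) s n = continuant x y (s + t) n := by
  induction n using Nat.twoStepInduction with
  | zero => simp [continuant]
  | one => simp [continuant]
  | more n ih₀ ih₁ =>
    simp only [continuant_add_two, ih₀, ih₁, add_right_comm _ _ t]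

end Continuant

section Tiling

/-- No two elements of `I` are adjacent. -/
abbrev IsSparse (I : Finset ℕ) : Prop := ∀ i ∈ I, ∀ j ∈ I, i < j → i + 2 ≤ j

theorem IsSparse.card_le {I : Finset ℕ} (hI : IsSparse I) {s r : ℕ}
    (hsub : I ⊆ Finset.Ioo s (s + r)) : I.card ≤ r / 2 := by
  have hdisj : Disjoint I (I.image (· + 1)) := by
    rw [Finset.disjoint_left]
    intro i hi hi'
    obtain ⟨j, hj, rfl⟩ := Finset.mem_image.1 hi'
    have := hI j hj (j + 1) hi (by omega)
    omega
  have hunion : I ∪ I.image (· + 1) ⊆ Finset.Ioc s (s + r) := by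
    intro i hi
    rcases Finset.mem_union.1 hi with hi | hi
    · have := Finset.mem_Ioo.1 (hsub hi)
      exact Finset.mem_Ioc.2 (by omega)
    · obtain ⟨j, hj, rfl⟩ := Finset.mem_image.1 hi
      have := Finset.mem_Ioo.1 (hsub hj)
      exact Finset.mem_Ioc.2 (by omega)
  have hcard := Finset.card_le_card hunion
  rw [Finset.card_union_of_disjoint hdisj,
    Finset.card_image_of_injective _ (add_left_injective 1), Nat.card_Ioc] at hcard
  omega

variable {R : Type*} [CommRing R] (x y : ℕ → R)

/-- The monomial obtained from `x_{s+1} ⋯ x_{s+r}` by replacing `x_i x_{i+1}` by `y_i` for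
each `i ∈ I`. -/
def tilingMono (s r : ℕ) (I : Finset ℕ) : R :=
  (∏ i ∈ I, y i) * ∏ j ∈ (Finset.Ioc s (s + r)).filter (fun j => j ∉ I ∧ j - 1 ∉ I), x j

theorem tilingMono_succ {s r : ℕ} {I : Finset ℕ} (hI : I ⊆ Finset.Ioo s (s + r)) :
    tilingMono x y s (r + 1) I = x (s + r + 1) * tilingMono x y s r I := by
  have h₁ : s + r + 1 ∉ I := fun h => by have := Finset.mem_Ioo.1 (hI h); omega
  have h₂ : s + r ∉ I := fun h => by have := Finset.mem_Ioo.1 (hI h); omega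
  have hset : (Finset.Ioc s (s + (r + 1))).filter (fun j => j ∉ I ∧ j - 1 ∉ I) =
      insert (s + r + 1) ((Finset.Ioc s (s + r)).filter (fun j => j ∉ I ∧ j - 1 ∉ I)) := by
    ext j
    simp only [Finset.mem_filter, Finset.mem_insert, Finset.mem_Ioc]
    constructor
    · rintro ⟨h, h'⟩
      by_cases hj : j = s + r + 1
      · exact Or.inl hj
      · exact Or.inr ⟨by omega, h'⟩
    · rintro (rfl | ⟨h, h'⟩)
      · exact ⟨by omega, h₁, by simpa using h₂⟩
      · exact ⟨by omega, h'⟩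
  rw [tilingMono, tilingMono, hset, Finset.prod_insert (by simp)]
  ring

theorem tilingMono_insert {s r : ℕ} {I : Finset ℕ} (hI : I ⊆ Finset.Ioo s (s + r)) :
    tilingMono x y s (r + 2) (insert (s + r + 1) I) =
      y (s + r + 1) * tilingMono x y s r I := by
  have h₁ : s + r + 1 ∉ I := fun h => by have := Finset.mem_Ioo.1 (hI h); omega
  have hset : (Finset.Ioc s (s + (r + 2))).filter
        (fun j => j ∉ insert (s + r + 1) I ∧ j - 1 ∉ insert (s + r + 1) I) =
      (Finset.Ioc s (s + r)).filter (fun j => j ∉ I ∧ j - 1 ∉ I) := by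
    ext j
    simp only [Finset.mem_filter, Finset.mem_insert, Finset.mem_Ioc, not_or]
    constructor
    · rintro ⟨h, h', h''⟩
      exact ⟨by omega, h'.2, h''.2⟩
    · rintro ⟨h, h', h''⟩
      exact ⟨by omega, ⟨by omega, h'⟩, by omega, h''⟩
  rw [tilingMono, tilingMono, hset, Finset.prod_insert h₁]
  ring

/-- The sum of the tiling monomials over all sparse `I`. -/
def tilingSum (s r : ℕ) : R :=
  ∑ I ∈ (Finset.Ioo s (s + r)).powerset.filter IsSparse, tilingMono x y s r I

theorem tilingSum_add_two (s r : ℕ) : tilingSum x y s (r + 2) =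
    x (s + r + 2) * tilingSum x y s (r + 1) + y (s + r + 1) * tilingSum x y s r := by
  have hset : Finset.Ioo s (s + (r + 2)) = insert (s + r + 1) (Finset.Ioo s (s + (r + 1))) := by
    ext j
    simp only [Finset.mem_insert, Finset.mem_Ioo]
    omega
  simp only [tilingSum, Finset.sum_filter]
  rw [hset, Finset.sum_powerset_insert (by simp; omega)]
  congr 1
  · rw [Finset.mul_sum]
    refine Finset.sum_congr rfl fun I hI => ?_
    rw [tilingMono_succ x y (Finset.mem_powerset.1 hI)]
    split_ifs
    · rfl
    · simp
  · rw [Finset.mul_sum]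
    symm
    apply Finset.sum_subset_zero_on_sdiff
    · exact Finset.powerset_mono.2 (Finset.Ioo_subset_Ioo le_rfl (by omega))
    · intro I hI
      rw [Finset.mem_sdiff, Finset.mem_powerset, Finset.mem_powerset] at hI
      refine if_neg fun hsp => hI.2 fun i hi => ?_
      have h₁ := Finset.mem_Ioo.1 (hI.1 hi)
      have h₂ := hsp i (Finset.mem_insert_of_mem hi) (s + r + 1)
        (Finset.mem_insert_self _ _) (by omega)
      exact Finset.mem_Ioo.2 (by omega)
    · intro I hI
      have hI := Finset.mem_powerset.1 hI
      have hiff : IsSparse (insert (s + r + 1) I) ↔ IsSparse I := by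
        refine ⟨fun h i hi j hj => h i (Finset.mem_insert_of_mem hi) j
          (Finset.mem_insert_of_mem hj), fun h i hi j hj hij => ?_⟩
        rcases Finset.mem_insert.1 hi with hi | hi <;> rcases Finset.mem_insert.1 hj with hj | hj
        · omega
        · have := Finset.mem_Ioo.1 (hI hj)
          omega
        · have := Finset.mem_Ioo.1 (hI hi)
          omega
        · exact h i hi j hj hij
      rw [tilingMono_insert x y hI]
      simp only [hiff]
      split_ifs
      · rfl
      · simp

theorem tilingSum_eq_continuant (s r : ℕ) : tilingSum x y s r = continuant x y s (r + 1) := by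
  have hempty : IsSparse ∅ := by simp [IsSparse]
  induction r using Nat.twoStepInduction with
  | zero => simp [tilingSum, tilingMono, continuant, Finset.filter_singleton, if_pos hempty]
  | one =>
    have h : Finset.Ioo s (s + 1) = ∅ := Finset.eq_empty_of_forall_notMem fun i hi => by
      have := Finset.mem_Ioo.1 hi
      omega
    simp [tilingSum, tilingMono, continuant, h, Finset.filter_singleton, if_pos hempty]
  | more r ih₀ ih₁ =>
    rw [tilingSum_add_two, ih₀, ih₁, continuant_add_two x y s (r + 1)]
    simp only [add_assoc, Nat.reduceAdd]

theorem sum_C2_eq_sum_sparse (s r : ℕ) (f : Finset ℕ → R) :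
    ∑ m ∈ Finset.range (r / 2 + 1), ∑ I ∈ C2 (Finset.Ioo s (s + r)) m, f I =
      ∑ I ∈ (Finset.Ioo s (s + r)).powerset.filter IsSparse, f I := by
  have hmaps : ∀ I ∈ (Finset.Ioo s (s + r)).powerset.filter IsSparse,
      I.card ∈ Finset.range (r / 2 + 1) := fun I hI => by
    rw [Finset.mem_filter, Finset.mem_powerset] at hI
    exact Finset.mem_range.2 (Nat.lt_succ_of_le (hI.2.card_le hI.1))
  rw [← Finset.sum_fiberwise_of_maps_to hmaps]
  refine Finset.sum_congr rfl fun m _ => Finset.sum_congr ?_ fun _ _ => rfl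
  ext I
  simp only [C2, Finset.mem_filter, Finset.mem_powersetCard, Finset.mem_powerset]
  tauto

end Tiling

theorem alphaComb_eq_continuant (k r : ℕ) :
    alphaComb k r = continuant (Xv k) (Yv k) 0 (r + 1) := by
  have h : Finset.Icc 1 (r - 1) = Finset.Ioo 0 (0 + r) := by
    ext; simp only [Finset.mem_Icc, Finset.mem_Ioo]; omega
  have h' : Finset.Icc 1 r = Finset.Ioc 0 (0 + r) := by
    ext; simp only [Finset.mem_Icc, Finset.mem_Ioc]; omega
  rw [← tilingSum_eq_continuant, alphaComb, h, sum_C2_eq_sum_sparse]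
  refine Finset.sum_congr rfl fun I _ => ?_
  rw [pMono, tilingMono, h']

theorem alphaN_eq_continuant {k r : ℕ} (h : r ≤ k) :
    alphaN k r = continuant (Xv k) (Yv k) 0 (r + 1) := by
  rw [alphaN, dif_pos h, alphaComb_eq_continuant]

theorem alphaZ_eq_continuant {k n : ℕ} (h : n ≤ k + 1) :
    alphaZ k ((n : ℤ) - 1) = continuant (Xv k) (Yv k) 0 n := by
  rcases n with _ | n
  · simp [alphaZ, continuant]
  · rw [← alphaN_eq_continuant (by omega), alphaZ, if_neg (by omega)]
    congr 1
    omega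

theorem betaP_succ_eq_continuant (k r : ℕ) :
    betaP k (r + 1) = Yv k k * continuant (Xv k) (Yv k) 1 r := by
  rcases r with _ | r
  · simp [betaP, continuant]
  · have h : Finset.Icc 2 r = Finset.Ioo 1 (1 + r) := by
      ext; simp only [Finset.mem_Icc, Finset.mem_Ioo]; omega
    have h' : Finset.Icc 2 (r + 2 - 1) = Finset.Ioc 1 (1 + r) := by
      ext; simp only [Finset.mem_Icc, Finset.mem_Ioc]; omega
    rw [← tilingSum_eq_continuant, betaP, h, sum_C2_eq_sum_sparse, tilingSum, Finset.mul_sum]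
    refine Finset.sum_congr rfl fun I _ => ?_
    rw [qMono, tilingMono, h', mul_assoc]

section GenFib

variable {K : Type*} [CommRing K] (x y : K)

theorem genFib_succ_eq_sum_range {m N : ℕ} (h : m / 2 + 1 ≤ N) :
    genFib x y (m + 1) = ∑ i ∈ Finset.range N,
      (-1 : K) ^ i * (Nat.choose (m - i) i : K) * x ^ (m - 2 * i) * y ^ i := by
  rw [genFib]
  refine Finset.sum_subset (Finset.range_mono h) fun i _ hi => ?_
  rw [Finset.mem_range, not_lt] at hi
  simp [Nat.choose_eq_zero_of_lt (show m - i < i by omega)]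

theorem genFib_add_two (m : ℕ) :
    genFib x y (m + 2) = x * genFib x y (m + 1) - y * genFib x y m := by
  rcases m with _ | m
  · simp [genFib]
  rw [genFib_succ_eq_sum_range x y (m := m + 2) (N := m + 3) (by omega),
    genFib_succ_eq_sum_range x y (m := m + 1) (N := m + 3) (by omega),
    genFib_succ_eq_sum_range x y (m := m) (N := m + 2) (by omega),
    Finset.sum_range_succ', Finset.sum_range_succ' _ (m + 2), mul_add, Finset.mul_sum,
    Finset.mul_sum, add_sub_right_comm, ← Finset.sum_sub_distrib]
  congr 1
  · refine Finset.sum_congr rfl fun i _ => ?_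
    rcases Nat.lt_or_ge m i with hi | hi
    · simp [Nat.choose_eq_zero_of_lt (show m + 1 - i < i + 1 by omega),
        Nat.choose_eq_zero_of_lt (show m - i < i + 1 by omega),
        Nat.choose_eq_zero_of_lt (show m - i < i by omega)]
    · rw [show m + 2 - (i + 1) = (m - i) + 1 by omega, Nat.choose_succ_succ,
        show m + 1 - (i + 1) = m - i by omega, show m + 2 - 2 * (i + 1) = m - 2 * i by omega]
      rcases Nat.lt_or_ge m (2 * i + 1) with hi' | hi'
      · rw [Nat.choose_eq_zero_of_lt (show m - i < i + 1 by omega)]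
        push_cast
        ring
      · rw [show m - 2 * i = (m + 1 - 2 * (i + 1)) + 1 by omega]
        push_cast
        ring
  · simp
    ring

end GenFib

section Determinant

variable {K : Type*} [CommRing K]

/-- The `n × n` tridiagonal matrix with entries taken from the sequences `a, b, c` after
position `s`. -/
def tridiag (a b c : ℕ → K) (s n : ℕ) : Matrix (Fin n) (Fin n) K :=
  Matrix.of fun i j =>
    if (i : ℕ) = (j : ℕ) then a (s + i + 1)
    else if (j : ℕ) = (i : ℕ) + 1 then b (s + i + 1)
    else if (i : ℕ) = (j : ℕ) + 1 then c (s + j + 1)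
    else 0

theorem tridiag_submatrix_succ (a b c : ℕ → K) (s n : ℕ) :
    (tridiag a b c s (n + 1)).submatrix Fin.succ Fin.succ = tridiag a b c (s + 1) n := by
  ext i j
  simp [tridiag, add_assoc, add_comm 1]

theorem det_tridiag_add_two (a b c : ℕ → K) (s n : ℕ) :
    (tridiag a b c s (n + 2)).det = a (s + 1) * (tridiag a b c (s + 1) (n + 1)).det -
      b (s + 1) * c (s + 1) * (tridiag a b c (s + 2) n).det := by
  have hminor : ((tridiag a b c s (n + 2)).submatrix Fin.succ (Fin.succAbove 1)).det =
      c (s + 1) * (tridiag a b c (s + 2) n).det := by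
    have hsub : ((tridiag a b c s (n + 2)).submatrix Fin.succ (Fin.succAbove 1)).submatrix
        Fin.succ Fin.succ = tridiag a b c (s + 2) n := by
      rw [← tridiag_submatrix_succ, ← tridiag_submatrix_succ]
      ext i j
      simp [Fin.one_succAbove_succ]
    rw [Matrix.det_succ_column_zero, Fin.sum_univ_succ, Finset.sum_eq_zero]
    · simp only [Fin.succAbove_zero, hsub]
      simp [tridiag]
    · intro i _
      simp [tridiag]
  rw [Matrix.det_succ_row_zero, Fin.sum_univ_succ, Fin.sum_univ_succ, Finset.sum_eq_zero]
  · simp only [Fin.succAbove_zero, tridiag_submatrix_succ, Fin.succ_zero_eq_one, hminor]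
    simp [tridiag]
    ring
  · intro j _
    simp [tridiag]

theorem det_tridiag (a b c : ℕ → K) (s n : ℕ) :
    (tridiag a b c s n).det = continuant a (fun i => -(b i * c i)) s (n + 1) := by
  induction n using Nat.twoStepInduction generalizing s with
  | zero => simp [continuant]
  | one => simp [continuant, tridiag]
  | more n ih₀ ih₁ =>
    rw [det_tridiag_add_two, ih₀, ih₁, continuant_add_two' _ _ s (n + 1)]
    ring

end Determinant

section Periodic

variable {K : Type*} [CommRing K] (a d : ℕ → K)

/-- The solution of the continuant recurrence with initial values `u` and `v`. -/
def contRec (u v : K) : ℕ → K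
  | 0 => u
  | 1 => v
  | n + 2 => a (n + 1) * contRec u v (n + 1) - d n * contRec u v n

theorem contRec_eq_prod_mul_continuant {k : ℕ} (hk : 1 ≤ k) {j : ℕ} (hj : j ≤ k) :
    contRec a d (continuant a (-d) 0 k) (d 0 * continuant a (-d) 1 (k - 1)) j =
      (∏ i ∈ Finset.range j, d i) * continuant a (-d) j (k - j) := by
  induction j using Nat.twoStepInduction with
  | zero => simp [contRec]
  | one => simp [contRec]
  | more j ih₀ ih₁ =>
    obtain ⟨l, rfl⟩ := Nat.exists_eq_add_of_le hj
    rw [contRec, ih₀ (by omega), ih₁ (by omega), show j + 2 + l - j = l + 2 by omega,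
      show j + 2 + l - (j + 1) = l + 1 by omega, show j + 2 + l - (j + 2) = l by omega,
      continuant_add_two' _ _ j l, Finset.prod_range_succ _ (j + 1), Finset.prod_range_succ _ j]
    simp only [Pi.neg_apply]
    ring

theorem continuant_mul_add {k : ℕ} (hk : 1 ≤ k) (ha : ∀ i, a (i + k) = a i)
    (hd : ∀ i, d (i + k) = d i) {p q : K}
    (hp : p = continuant a (-d) 0 (k + 1) - d 0 * continuant a (-d) 1 (k - 1))
    (hq : q = ∏ i ∈ Finset.range k, d i) (m j : ℕ) :
    continuant a (-d) 0 (m * k + j) =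
      genFib p q (m + 1) * continuant a (-d) 0 j + genFib p q m *
        contRec a d (continuant a (-d) 0 k) (d 0 * continuant a (-d) 1 (k - 1)) j := by
  induction m generalizing j with
  | zero => simp [genFib]
  | succ m ih =>
    rw [show (m + 1) * k + j = m * k + (j + k) by ring, ih]
    have h₀ := contRec_eq_prod_mul_continuant a d hk le_rfl
    rw [Nat.sub_self, continuant_zero, mul_zero] at h₀
    have h₁ : contRec a d (continuant a (-d) 0 k) (d 0 * continuant a (-d) 1 (k - 1)) (k + 1) =
        -q := by
      obtain ⟨l, rfl⟩ := Nat.exists_eq_add_of_le' hk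
      rw [contRec, h₀, contRec_eq_prod_mul_continuant a d hk (by omega), hq,
        Finset.prod_range_succ, Nat.add_sub_cancel_left, continuant_one]
      ring
    induction j using Nat.twoStepInduction with
    | zero => rw [zero_add, h₀, continuant_zero, contRec]; ring
    | one =>
      rw [add_comm 1 k, h₁, continuant_one, genFib_add_two, contRec, hp]
      ring
    | more j ih₀ ih₁ =>
      rw [show j + 2 + k = (j + k) + 2 by ring, continuant_add_two, contRec,
        continuant_add_two, contRec, show j + k + 1 = (j + 1) + k by ring,
        show 0 + (j + k) + 1 = (j + 1) + k by ring, ha, zero_add, zero_add]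
      simp only [Pi.neg_apply, hd]
      linear_combination a (j + 1) * ih₁ - d j * ih₀

end Periodic

/-- **Determinant of a tridiagonal `k`-Toeplitz matrix, second formula.**
Let `K` be a commutative unital ring, `k ≥ 1`, `n > k`, and `ā, b̄, c̄ ∈ K^k`.
Set `d_i := b_i·c_i`, `d := d_1⋯d_k`, and write `n = m·k + r` by Euclidean
division. With `U(i) := U_i(π^{ā,−d̄}(k,k), d)` the generalized Fibonacci
polynomials, one has
`det(T^k_n(ā,b̄,c̄)) = U(m+1)·α^{ā,−d̄}(r,k) + d_k·d_1⋯d_r·U(m)·α_{r+1}^{ā,−d̄}(k−r−2,k)`,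
where `α_{r+1}` denotes the shift of `α` by `r+1` and `α(−1,k) = 0`. -/
theorem det_triToeplitz_formula₂ {K : Type*} [CommRing K] {k n : ℕ}
    (hk : 1 ≤ k) (hkn : k < n) (a b c : ZMod k → K)
    (d : ZMod k → K) (hd : ∀ i, d i = b i * c i)
    (dtot : K) (hdtot : dtot = ∏ p ∈ Finset.Icc 1 k, d ((p : ℕ) : ZMod k))
    (m r : ℕ) (hm : m = n / k) (hr : r = n % k) :
    (triToeplitz k n a b c).det =
      genFib (MvPolynomial.aeval (Sum.elim a fun i => -d i) (piP k k)) dtot (m + 1) *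
          MvPolynomial.aeval (Sum.elim a fun i => -d i) (alphaN k r) +
        (d ((k : ℕ) : ZMod k) * ∏ p ∈ Finset.Icc 1 r, d ((p : ℕ) : ZMod k)) *
          genFib (MvPolynomial.aeval (Sum.elim a fun i => -d i) (piP k k)) dtot m *
          MvPolynomial.aeval (Sum.elim a fun i => -d i)
            (shiftP k (r + 1) (alphaZ k ((k : ℤ) - r - 2))) := by
  have hrk : r < k := hr ▸ Nat.mod_lt _ hk
  have hn : n + 1 = m * k + (r + 1) := by
    rw [hm, hr, ← add_assoc, Nat.div_add_mod']
  set A : ℕ → K := fun i => a (i : ZMod k) with hA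
  set D : ℕ → K := fun i => d (i : ZMod k) with hD
  set φ := MvPolynomial.aeval (R := ℤ) (Sum.elim a fun i => -d i) with hφ
  have hdet : (triToeplitz k n a b c).det = continuant A (-D) 0 (n + 1) := by
    have hmat : triToeplitz k n a b c = tridiag A (fun i => b i) (fun i => c i) 0 n := by
      ext i j
      simp [triToeplitz, tridiag, hA]
    rw [hmat, det_tridiag]
    congr 1
    funext i
    simp [hD, hd]
  have hφc (s l : ℕ) : φ (continuant (Xv k) (Yv k) s l) = continuant A (-D) s l := by
    refine (map_continuant _ _ (φ : ContRing k →+* K) s l).trans ?_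
    congr 1 <;> funext i <;> simp [hφ, hA, hD, Xv, Yv]
  have hshift (l : ℕ) : φ (shiftP k (r + 1) (continuant (Xv k) (Yv k) 0 l)) =
      continuant A (-D) (r + 1) l := by
    refine (map_continuant _ _ ((φ.comp (shiftP k (r + 1)) : ContRing k →ₐ[ℤ] K) :
      ContRing k →+* K) 0 l).trans ?_
    rw [← zero_add (r + 1), ← continuant_shift]
    congr 1 <;> funext i <;> simp [hφ, hA, hD, Xv, Yv, shiftP]
  have hD0 : d (k : ZMod k) = D 0 := by simp [hD]
  have hprod (l : ℕ) : D 0 * ∏ p ∈ Finset.Icc 1 l, d (p : ZMod k) =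
      ∏ i ∈ Finset.range (l + 1), D i := by
    induction l with
    | zero => simp
    | succ l ih =>
      rw [Finset.prod_Icc_succ_top (by omega), ← mul_assoc, ih, Finset.prod_range_succ _ (l + 1)]
  have hpi : φ (piP k k) = continuant A (-D) 0 (k + 1) - D 0 * continuant A (-D) 1 (k - 1) := by
    have hbeta := betaP_succ_eq_continuant k (k - 1)
    rw [Nat.sub_add_cancel hk] at hbeta
    rw [piP, map_add, alphaN_eq_continuant le_rfl, hφc, hbeta, map_mul, hφc]
    simp [hφ, Yv, hD]
    ring
  have hdtot' : dtot = ∏ i ∈ Finset.range k, D i := by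
    obtain ⟨l, rfl⟩ := Nat.exists_eq_add_of_le' hk
    rw [hdtot, ← hprod, Finset.prod_Icc_succ_top (by omega), hD0, mul_comm]
  rw [hdet, hn, continuant_mul_add A D hk (by simp [hA]) (by simp [hD]) hpi hdtot',
    contRec_eq_prod_mul_continuant A D hk hrk, alphaN_eq_continuant hrk.le, hφc, hD0, hprod,
    show (k : ℤ) - r - 2 = ((k - (r + 1) : ℕ) : ℤ) - 1 by omega,
    alphaZ_eq_continuant (by omega), hshift]
  ring

end
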